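/- Let v : Ω̄×[0,T] → ℝ² be smooth. Then ‖∂₁³Dv(t)‖_{L^∞(Ω)} ≤ C E(t,v)^{1/2} for t ∈ [0,T]. Consequently, if η(x,t) = x + ∫₀ᵗ v(x,s) ds, then ‖∂₁³Dη(t)‖_{L^∞(Ω)} ≤ C t sup_{0≤s≤t} E(s,v)^{1/2}, with C depending only on Ω, C₁, C₂. -/

import Mathlib

open MeasureTheory Real Filter

noncomputable section

/-- The reference domain `Ω = 𝕋 × (0,1)`, realized as the fundamental square `(0,1) × (0,1)`. -/
def Oset : Set (ℝ × ℝ) := Set.Ioo (0:ℝ) 1 ×ˢ Set.Ioo (0:ℝ) 1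

/-- The vacuum boundary `Γ = 𝕋 × {0,1}`. -/
def Gset : Set (ℝ × ℝ) := {x : ℝ × ℝ | x.2 = 0 ∨ x.2 = 1}

/-- Distance to the boundary `Γ`. -/
def distG (x : ℝ × ℝ) : ℝ := min x.2 (1 - x.2)

variable {F : Type*} [NormedAddCommGroup F] [NormedSpace ℝ F]

/-- Horizontal partial derivative `∂₁`. -/
def pd1 (f : ℝ × ℝ → F) : ℝ × ℝ → F := fun x => fderiv ℝ f x (1, 0)

/-- Vertical (normal) partial derivative `∂₂`. -/
def pd2 (f : ℝ × ℝ → F) : ℝ × ℝ → F := fun x => fderiv ℝ f x (0, 1)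

/-- Time derivative `∂ₜ`. -/
def pdt (v : ℝ → ℝ × ℝ → F) : ℝ → ℝ × ℝ → F := fun t x => deriv (fun s => v s x) t

/-- `|Df|²` at a point. -/
def gradSq (f : ℝ × ℝ → F) (x : ℝ × ℝ) : ℝ := ‖pd1 f x‖ ^ 2 + ‖pd2 f x‖ ^ 2

/-- 1-periodicity in the horizontal variable (functions on the torus `𝕋 × (0,1)`). -/
def Per (f : ℝ × ℝ → F) : Prop := ∀ x : ℝ × ℝ, f (x.1 + 1, x.2) = f x

/-- Smoothness. -/
def SmoothFn (f : ℝ × ℝ → F) : Prop := ∀ n : ℕ, ContDiff ℝ n f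

/-- Joint smoothness of a time dependent family. -/
def SmoothT (v : ℝ → ℝ × ℝ → F) : Prop :=
  ∀ n : ℕ, ContDiff ℝ n (fun p : ℝ × (ℝ × ℝ) => v p.1 p.2)

def PerT (v : ℝ → ℝ × ℝ → F) : Prop := ∀ t : ℝ, Per (v t)

/-- Admissible initial depth profile: smooth, periodic, vanishing on `Γ` and
comparable to the distance to the boundary. -/
def IsDensity (C₁ C₂ : ℝ) (ρ₀ : ℝ × ℝ → ℝ) : Prop :=
  SmoothFn ρ₀ ∧ Per ρ₀ ∧ (∀ x ∈ Gset, ρ₀ x = 0) ∧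
    ∀ x ∈ Oset, C₁ * distG x ≤ ρ₀ x ∧ ρ₀ x ≤ C₂ * distG x

/-- The higher-order energy functional `E(t,v)`. -/
def energy (ρ₀ : ℝ × ℝ → ℝ) (v : ℝ → ℝ × ℝ → ℝ × ℝ) (t : ℝ) : ℝ :=
  (∑ l₀ ∈ Finset.range 5, ∫ x in Oset, ρ₀ x * ‖(pdt^[l₀] v) t x‖ ^ 2)
    + (∑ l₀ ∈ Finset.range 4, ∑ l₁ ∈ Finset.range (7 - 2 * l₀),
        ∫ x in Oset, ρ₀ x *
          (gradSq (pd1^[l₁] ((pdt^[l₀] v) t)) x + gradSq (pd1^[l₁ + 1] ((pdt^[l₀] v) t)) x))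
    + ∑ l₀ ∈ Finset.range 4, ∑ l₁ ∈ Finset.range (7 - 2 * l₀),
        ∑ l₂ ∈ Finset.Icc 2 (8 - 2 * l₀ - l₁),
          ∫ x in Oset, ρ₀ x ^ l₂ * ‖(pd1^[l₁] (pd2^[l₂] ((pdt^[l₀] v) t))) x‖ ^ 2

/-- The Lagrangian flow map `η(x,t) = x + ∫₀ᵗ v(x,s) ds`. -/
def flowMap (v : ℝ → ℝ × ℝ → ℝ × ℝ) (t : ℝ) (x : ℝ × ℝ) : ℝ × ℝ :=
  x + ∫ s in (0:ℝ)..t, v s x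

/-- The (squared-sum) Sobolev `H^k(Ω)` norm. -/
def sobolevNorm (k : ℕ) (f : ℝ × ℝ → F) : ℝ :=
  Real.sqrt (∑ θ ∈ Finset.range (k + 1), ∫ x in Oset, ‖iteratedFDeriv ℝ θ f x‖ ^ 2)

/-- `sup_{0 ≤ s ≤ t} E(s,v)^{1/2}`. -/
def supEn (ρ₀ : ℝ × ℝ → ℝ) (v : ℝ → ℝ × ℝ → ℝ × ℝ) (t : ℝ) : ℝ :=
  ⨆ s : Set.Icc (0:ℝ) t, Real.sqrt (energy ρ₀ v ↑s)

/-- Weighted `L²(Ω)` norm `‖ρ₀^p ∂₁^{l₁} D^k f‖_{L²(Ω)}`. -/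
def wL2 (ρ₀ : ℝ × ℝ → ℝ) (p k l₁ : ℕ) (f : ℝ × ℝ → F) : ℝ :=
  Real.sqrt (∫ x in Oset, (ρ₀ x ^ p * ‖iteratedFDeriv ℝ k (pd1^[l₁] f) x‖) ^ 2)

/-- Weighted `L^∞(Ω)` norm `‖ρ₀^p ∂₁^{l₁} D^k f‖_{L^∞(Ω)}`. -/
def wSup (ρ₀ : ℝ × ℝ → ℝ) (p k l₁ : ℕ) (f : ℝ × ℝ → F) : ℝ :=
  ⨆ x : Oset, ρ₀ (x : ℝ × ℝ) ^ p * ‖iteratedFDeriv ℝ k (pd1^[l₁] f) (x : ℝ × ℝ)‖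

def pick (i : Fin 2) (w : ℝ × ℝ) : ℝ := if i = 0 then w.1 else w.2

def evec (k : Fin 2) : ℝ × ℝ := if k = 0 then (1, 0) else (0, 1)

def pdk (k : Fin 2) (f : ℝ × ℝ → ℝ) : ℝ × ℝ → ℝ := fun x => fderiv ℝ f x (evec k)

/-- The cofactor matrix `a` of `Dη`, `a = [[∂₂η², −∂₂η¹], [−∂₁η², ∂₁η¹]]`,
indexed so that `cof η x i k = a_i^k`. -/
def cof (η : ℝ × ℝ → ℝ × ℝ) (x : ℝ × ℝ) (i k : Fin 2) : ℝ :=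
  if i = 0 then
    (if k = 0 then pd2 (fun y => (η y).2) x else -pd1 (fun y => (η y).2) x)
  else
    (if k = 0 then -pd2 (fun y => (η y).1) x else pd1 (fun y => (η y).1) x)

/-- The Jacobian determinant `J = det Dη`. -/
def jac (η : ℝ × ℝ → ℝ × ℝ) (x : ℝ × ℝ) : ℝ :=
  pd1 (fun y => (η y).1) x * pd2 (fun y => (η y).2) x
    - pd2 (fun y => (η y).1) x * pd1 (fun y => (η y).2) x

/-- `b^{kj} = a_l^k a_l^j`. -/
def bmat (η : ℝ × ℝ → ℝ × ℝ) (x : ℝ × ℝ) (k j : Fin 2) : ℝ :=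
  ∑ l : Fin 2, cof η x l k * cof η x l j

/-- `(v,η)` is a (classical) solution of the Lagrangian system
`ρ₀ ∂ₜ v^i + (ρ₀² J⁻² a_i^k),_k = (ρ₀ J⁻² b^{kj} v^i,_j),_k` in `Ω × (0,T]`. -/
def IsLagSol (ρ₀ : ℝ × ℝ → ℝ) (v : ℝ → ℝ × ℝ → ℝ × ℝ) (T : ℝ) : Prop :=
  ∀ t : ℝ, 0 < t → t ≤ T → ∀ x ∈ Oset, ∀ i : Fin 2,
    ρ₀ x * pick i (pdt v t x)
        + ∑ k : Fin 2, pdk k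
            (fun y => ρ₀ y ^ 2 * jac (flowMap v t) y ^ (-2 : ℤ) * cof (flowMap v t) y i k) x
      = ∑ k : Fin 2, pdk k
          (fun y => ρ₀ y * jac (flowMap v t) y ^ (-2 : ℤ) *
            ∑ j : Fin 2, bmat (flowMap v t) y k j * pdk j (fun z => pick i (v t z)) y) x

/-- The a priori assumption: `sup_{0≤t≤T} E(t,v) ≤ M₁`,
`T ∈ (0, 1/(20c₁c₂√M₁ + 10c₁²c₂²M₁)] ∩ (0,1)`, where `c₁, c₂` are the constants of the
embedding inequalities, so that in particular `‖Dv‖_{L^∞} ≤ c₁c₂ E^{1/2}`. -/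
def Apriori (ρ₀ : ℝ × ℝ → ℝ) (v : ℝ → ℝ × ℝ → ℝ × ℝ) (T M₁ c₁ c₂ : ℝ) : Prop :=
  0 < c₁ ∧ 0 < c₂ ∧ 0 ≤ M₁ ∧ 0 < T ∧ T ≤ 1 ∧
    T ≤ 1 / (20 * c₁ * c₂ * Real.sqrt M₁ + 10 * c₁ ^ 2 * c₂ ^ 2 * M₁) ∧
    (∀ t ∈ Set.Icc (0:ℝ) T, energy ρ₀ v t ≤ M₁) ∧
    ∀ t ∈ Set.Icc (0:ℝ) T, ∀ x ∈ Oset,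
      ‖fderiv ℝ (v t) x‖ ≤ c₁ * c₂ * Real.sqrt (energy ρ₀ v t)

/-- Smooth test functions compactly supported in `Ω`. -/
def CinfTest (φ : ℝ × ℝ → ℝ) : Prop :=
  (∀ n : ℕ, ContDiff ℝ n φ) ∧ HasCompactSupport φ ∧ tsupport φ ⊆ Oset

/-- `g` is the weak directional derivative of `u` in direction `e` on `Ω`. -/
def WeakPD (e : ℝ × ℝ) (u g : ℝ × ℝ → ℝ) : Prop :=
  ∀ φ : ℝ × ℝ → ℝ, CinfTest φ →
    ∫ x in Oset, u x * fderiv ℝ φ x e = -∫ x in Oset, g x * φ x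

/-- Membership in the weighted space `H¹_{ρ₀}(Ω)`, with weak gradient `Dw`. -/
def InH1w (ρ₀ : ℝ × ℝ → ℝ) (w : ℝ × ℝ → ℝ) (Dw : ℝ × ℝ → ℝ × ℝ) : Prop :=
  AEStronglyMeasurable w (volume.restrict Oset) ∧
    AEStronglyMeasurable Dw (volume.restrict Oset) ∧
    IntegrableOn (fun x => ρ₀ x * (w x) ^ 2) Oset ∧
    IntegrableOn (fun x => ρ₀ x * ‖Dw x‖ ^ 2) Oset ∧
    WeakPD (1, 0) w (fun x => (Dw x).1) ∧ WeakPD (0, 1) w (fun x => (Dw x).2)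

/-- The bilinear form `B[w,φ]_μ = ∫_Ω ρ₀ (Dw·Dφ + wφ) dx`. -/
def Bform (ρ₀ : ℝ × ℝ → ℝ) (w : ℝ × ℝ → ℝ) (Dw : ℝ × ℝ → ℝ × ℝ)
    (φ : ℝ × ℝ → ℝ) (Dφ : ℝ × ℝ → ℝ × ℝ) : ℝ :=
  ∫ x in Oset, ρ₀ x * ((Dw x).1 * (Dφ x).1 + (Dw x).2 * (Dφ x).2 + w x * φ x)

open scoped ContDiff

lemma aux_pd1_smooth {f : ℝ × ℝ → F} (hf : ContDiff ℝ ∞ f) : ContDiff ℝ ∞ (pd1 f) := by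
  unfold pd1
  exact (hf.fderiv_right (m := ∞) (by simp)).clm_apply contDiff_const

lemma aux_pd2_smooth {f : ℝ × ℝ → F} (hf : ContDiff ℝ ∞ f) : ContDiff ℝ ∞ (pd2 f) := by
  unfold pd2
  exact (hf.fderiv_right (m := ∞) (by simp)).clm_apply contDiff_const

lemma aux_pd1_iter {f : ℝ × ℝ → F} (hf : ContDiff ℝ ∞ f) (n : ℕ) :
    ContDiff ℝ ∞ (pd1^[n] f) := by
  induction n with
  | zero => exact hf
  | succ k ih => rw [Function.iterate_succ_apply']; exact aux_pd1_smooth ih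

lemma aux_pd2_iter {f : ℝ × ℝ → F} (hf : ContDiff ℝ ∞ f) (n : ℕ) :
    ContDiff ℝ ∞ (pd2^[n] f) := by
  induction n with
  | zero => exact hf
  | succ k ih => rw [Function.iterate_succ_apply']; exact aux_pd2_smooth ih

lemma aux_comm {f : ℝ × ℝ → F} (hf : ContDiff ℝ ∞ f) : pd2 (pd1 f) = pd1 (pd2 f) := by
  funext x
  have hs : IsSymmSndFDerivAt ℝ f x := by
    apply (hf.contDiffAt (x := x)).isSymmSndFDerivAt
    simp only [minSmoothness_of_isRCLikeNormedField]
    exact (WithTop.coe_le_coe (a := ⊤) (b := (2 : ℕ∞))).2 le_top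
  have hd : DifferentiableAt ℝ (fderiv ℝ f) x :=
    ((hf.fderiv_right (m := ∞) (by simp)).differentiable (by simp)) x
  have h1 : ∀ e e' : ℝ × ℝ, fderiv ℝ (fun y => fderiv ℝ f y e) x e'
      = fderiv ℝ (fderiv ℝ f) x e' e := by
    intro e e'
    rw [fderiv_clm_apply hd (differentiableAt_const e)]
    simp
  unfold pd1 pd2
  rw [h1, h1]
  exact hs _ _

lemma aux_comm_iter {f : ℝ × ℝ → F} (hf : ContDiff ℝ ∞ f) (n : ℕ) :
    pd2 (pd1^[n] f) = pd1^[n] (pd2 f) := by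
  induction n with
  | zero => rfl
  | succ k ih =>
    rw [Function.iterate_succ_apply', aux_comm (aux_pd1_iter hf k), ih,
      Function.iterate_succ_apply']

/-- Composition with a continuous linear functional. -/
lemma aux_clm_pd1 {f : ℝ × ℝ → F} (hf : ContDiff ℝ ∞ f) (L : F →L[ℝ] ℝ) :
    pd1 (fun x => L (f x)) = fun x => L (pd1 f x) := by
  funext x
  have : HasFDerivAt (fun x => L (f x)) (L.comp (fderiv ℝ f x)) x :=
    L.hasFDerivAt.comp x ((hf.differentiable (by simp)) x).hasFDerivAt
  simp [pd1, this.fderiv]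

lemma aux_clm_pd2 {f : ℝ × ℝ → F} (hf : ContDiff ℝ ∞ f) (L : F →L[ℝ] ℝ) :
    pd2 (fun x => L (f x)) = fun x => L (pd2 f x) := by
  funext x
  have : HasFDerivAt (fun x => L (f x)) (L.comp (fderiv ℝ f x)) x :=
    L.hasFDerivAt.comp x ((hf.differentiable (by simp)) x).hasFDerivAt
  simp [pd2, this.fderiv]

lemma aux_hasDeriv1 {f : ℝ × ℝ → ℝ} (hf : ContDiff ℝ ∞ f) (x y : ℝ) :
    HasDerivAt (fun s => f (s, y)) (pd1 f (x, y)) x := by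
  have h1 : HasFDerivAt f (fderiv ℝ f (x, y)) (x, y) :=
    ((hf.differentiable (by simp)) (x, y)).hasFDerivAt
  have h2 : HasDerivAt (fun s : ℝ => (s, y)) ((1 : ℝ), (0 : ℝ)) x :=
    (hasDerivAt_id x).prodMk (hasDerivAt_const x y)
  exact h1.comp_hasDerivAt x h2

lemma aux_hasDeriv2 {f : ℝ × ℝ → ℝ} (hf : ContDiff ℝ ∞ f) (x y : ℝ) :
    HasDerivAt (fun s => f (x, s)) (pd2 f (x, y)) y := by
  have h1 : HasFDerivAt f (fderiv ℝ f (x, y)) (x, y) :=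
    ((hf.differentiable (by simp)) (x, y)).hasFDerivAt
  have h2 : HasDerivAt (fun s : ℝ => (x, s)) ((0 : ℝ), (1 : ℝ)) y :=
    (hasDerivAt_const y x).prodMk (hasDerivAt_id y)
  exact h1.comp_hasDerivAt y h2

lemma aux_int {f : ℝ × ℝ → ℝ} (hf : Continuous f) : IntegrableOn f Oset := by
  have : IntegrableOn f (Set.Icc (0:ℝ) 1 ×ˢ Set.Icc (0:ℝ) 1) :=
    hf.continuousOn.integrableOn_compact (isCompact_Icc.prod isCompact_Icc)
  exact this.mono_set (Set.prod_mono Set.Ioo_subset_Icc_self Set.Ioo_subset_Icc_self)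

lemma aux_meas : MeasurableSet Oset := measurableSet_Ioo.prod measurableSet_Ioo

lemma aux_fubini {f : ℝ × ℝ → ℝ} (hf : Continuous f) :
    ∫ x in Oset, f x = ∫ s in (0:ℝ)..1, ∫ r in (0:ℝ)..1, f (s, r) := by
  have h := setIntegral_prod (μ := volume) (ν := volume) f (aux_int hf)
  rw [Oset, Measure.volume_eq_prod, h]
  simp only [intervalIntegral.integral_of_le zero_le_one, integral_Ioc_eq_integral_Ioo]

/-- Weighted integral with weight `(x₂(1-x₂))^k`. -/
def Jw (k : ℕ) (f : ℝ × ℝ → ℝ) : ℝ := ∫ x in Oset, (x.2 * (1 - x.2)) ^ k * f x ^ 2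

lemma aux_Jw_nonneg (k : ℕ) (f : ℝ × ℝ → ℝ) : 0 ≤ Jw k f := by
  apply setIntegral_nonneg aux_meas
  rintro x ⟨-, h0, h1⟩
  have : 0 ≤ x.2 * (1 - x.2) := mul_nonneg h0.le (by linarith)
  positivity

lemma aux_Jw_succ (k : ℕ) {f : ℝ × ℝ → ℝ} (hf : ContDiff ℝ ∞ f) : Jw (k+1) f ≤ Jw k f := by
  have hc := hf.continuous
  apply setIntegral_mono_on (aux_int (by fun_prop)) (aux_int (by fun_prop)) aux_meas
  rintro x ⟨-, h0, h1⟩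
  have h2 : 0 ≤ x.2 * (1 - x.2) := mul_nonneg h0.le (by linarith)
  have h3 : x.2 * (1 - x.2) ≤ 1 := by nlinarith
  apply mul_le_mul_of_nonneg_right _ (sq_nonneg _)
  exact pow_le_pow_of_le_one h2 h3 (Nat.le_succ k)

lemma aux_hardy (k : ℕ) {f : ℝ × ℝ → ℝ} (hf : ContDiff ℝ ∞ f) :
    Jw k f ≤ (8 * k + 12) * Jw (k+1) f + 4 * Jw (k+2) (pd2 f) := by
  have hc := hf.continuous
  have hc2 := (aux_pd2_smooth hf).continuous
  set D : ℝ × ℝ → ℝ := fun x =>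
    (((k+1 : ℕ) : ℝ) * (x.2 * (1 - x.2)) ^ k * (1 * (1 - x.2) + x.2 * (-1)) * (1 - 2 * x.2)
      + (x.2 * (1 - x.2)) ^ (k+1) * (-2)) * f x ^ 2
    + (x.2 * (1 - x.2)) ^ (k+1) * (1 - 2 * x.2) * (2 * f x * pd2 f x) with hD
  have hDc : Continuous D := by fun_prop
  have hD0 : ∫ x in Oset, D x = 0 := by
    rw [aux_fubini hDc]
    have : ∀ s : ℝ, ∫ r in (0:ℝ)..1, D (s, r) = 0 := by
      intro s
      have hder : ∀ r ∈ Set.uIcc (0:ℝ) 1, HasDerivAt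
          (fun r => (r * (1 - r)) ^ (k+1) * (1 - 2 * r) * f (s, r) ^ 2) (D (s, r)) r := by
        intro r _
        have e1 : HasDerivAt (fun r : ℝ => r * (1 - r)) (1 * (1 - r) + r * (-1)) r :=
          (hasDerivAt_id r).mul ((hasDerivAt_id r).const_sub 1)
        have e2 := e1.pow (k+1)
        have e3 : HasDerivAt (fun r : ℝ => 1 - 2 * r) (-2) r := by
          simpa using ((hasDerivAt_id r).const_mul 2).const_sub 1
        have e4 := (aux_hasDeriv2 hf s r).pow 2
        have e5 := (e2.mul e3).mul e4
        refine HasDerivAt.congr_deriv (f := fun r => (r * (1 - r)) ^ (k+1) * (1 - 2 * r) * f (s, r) ^ 2) e5 ?_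
        simp [hD]
      rw [intervalIntegral.integral_eq_sub_of_hasDerivAt hder
        (Continuous.intervalIntegrable (by fun_prop) _ _)]
      simp
    simp [this]
  have i1 : IntegrableOn (fun x : ℝ × ℝ => (8 * (k:ℝ) + 12) * ((x.2 * (1 - x.2)) ^ (k+1) * f x ^ 2)) Oset :=
    aux_int (by fun_prop)
  have i2 : IntegrableOn (fun x : ℝ × ℝ => 4 * ((x.2 * (1 - x.2)) ^ (k+2) * pd2 f x ^ 2)) Oset :=
    aux_int (by fun_prop)
  have i3 : IntegrableOn (fun x : ℝ × ℝ => 2 * D x) Oset := aux_int (by fun_prop)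
  have key : Jw k f ≤ ∫ x in Oset, ((8 * (k:ℝ) + 12) * ((x.2 * (1 - x.2)) ^ (k+1) * f x ^ 2)
      + 4 * ((x.2 * (1 - x.2)) ^ (k+2) * pd2 f x ^ 2) + 2 * D x) := by
    apply setIntegral_mono_on (aux_int (by fun_prop)) (aux_int (by fun_prop)) aux_meas
    rintro x ⟨-, h0, h1⟩
    have h2 : 0 ≤ x.2 * (1 - x.2) := mul_nonneg h0.le (by linarith)
    have hP : 0 ≤ (x.2 * (1 - x.2)) ^ k := by positivity
    have hk : (0:ℝ) ≤ k := Nat.cast_nonneg k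
    simp only [hD]
    push_cast
    rw [pow_succ, pow_succ (x.2 * (1 - x.2)) k, show (x.2 * (1 - x.2)) ^ (k+2)
      = (x.2 * (1 - x.2)) ^ k * (x.2 * (1 - x.2))^2 by ring]
    generalize (x.2 * (1 - x.2)) ^ k = P at *
    generalize f x = a
    generalize pd2 f x = b
    generalize x.2 = y at *
    have e : (8 * (k:ℝ) + 12) * (P * (y * (1 - y)) * a ^ 2) + 4 * (P * (y * (1 - y)) ^ 2 * b ^ 2) +
      2 * (((k + 1) * P * (1 * (1 - y) + y * -1) * (1 - 2 * y) + P * (y * (1 - y)) * -2) * a ^ 2 +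
        P * (y * (1 - y)) * (1 - 2 * y) * (2 * a * b)) - P * a ^ 2
      = P * ((2 * k) * a^2 + ((1-2*y) * a + 2 * (y * (1-y)) * b)^2 + 4 * (y * (1-y)) * a^2) := by
      ring
    have : 0 ≤ P * ((2 * k) * a^2 + ((1-2*y) * a + 2 * (y * (1-y)) * b)^2
      + 4 * (y * (1-y)) * a^2) := by positivity
    linarith
  have i12 : IntegrableOn (fun x : ℝ × ℝ => (8 * (k:ℝ) + 12) * ((x.2 * (1 - x.2)) ^ (k+1) * f x ^ 2)
      + 4 * ((x.2 * (1 - x.2)) ^ (k+2) * pd2 f x ^ 2)) Oset := i1.add i2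
  rw [integral_add i12 i3, integral_add i1 i2, integral_const_mul, integral_const_mul,
    integral_const_mul, hD0] at key
  simpa [Jw] using key

lemma aux_sup1 {g g' : ℝ → ℝ} (hg : ∀ x, HasDerivAt g (g' x) x) (hg' : Continuous g') {y : ℝ}
    (hy : y ∈ Set.Icc (0:ℝ) 1) :
    g y ^ 2 ≤ ∫ s in (0:ℝ)..1, (2 * g s ^ 2 + g' s ^ 2) := by
  have hgc : Continuous g := continuous_iff_continuousAt.2 fun x => (hg x).continuousAt
  have h1 : ∀ z ∈ Set.Icc (0:ℝ) 1,
      g y ^ 2 - (∫ s in (0:ℝ)..1, (g s ^ 2 + g' s ^ 2)) ≤ g z ^ 2 := by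
    intro z hz
    have e : ∫ s in z..y, 2 * g s * g' s = g y ^ 2 - g z ^ 2 := by
      apply intervalIntegral.integral_eq_sub_of_hasDerivAt (f := fun s => g s ^ 2)
      · intro s _
        refine HasDerivAt.congr_deriv (f := fun s => g s ^ 2) ((hg s).pow 2) ?_
        simp
      · exact Continuous.intervalIntegrable (by fun_prop) _ _
    have e2 : ‖∫ s in z..y, 2 * g s * g' s‖ ≤ ∫ s in (0:ℝ)..1, (g s ^ 2 + g' s ^ 2) := by
      rw [intervalIntegral.integral_of_le zero_le_one]
      refine (intervalIntegral.norm_integral_le_integral_norm_uIoc).trans ?_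
      have hsub : Set.uIoc z y ⊆ Set.Ioc 0 1 := by
        intro s hs
        rw [Set.mem_uIoc] at hs
        rcases hs with hs | hs
        · exact ⟨hz.1.trans_lt hs.1, hs.2.trans hy.2⟩
        · exact ⟨hy.1.trans_lt hs.1, hs.2.trans hz.2⟩
      have hI : IntegrableOn (fun s => g s ^ 2 + g' s ^ 2) (Set.Ioc 0 1) :=
        (Continuous.integrableOn_Ioc (by fun_prop))
      calc ∫ s in Set.uIoc z y, ‖2 * g s * g' s‖
          ≤ ∫ s in Set.uIoc z y, (g s ^ 2 + g' s ^ 2) := by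
            apply setIntegral_mono_on _ (hI.mono_set hsub) measurableSet_uIoc
            · intro s _
              rw [Real.norm_eq_abs, abs_le]
              constructor <;> nlinarith [sq_nonneg (g s + g' s), sq_nonneg (g s - g' s)]
            · exact (Continuous.integrableOn_uIoc (by fun_prop))
        _ ≤ _ := setIntegral_mono_set hI (Eventually.of_forall fun s => by positivity)
            (LE.le.eventuallyLE hsub)
    have := (abs_le.1 (by simpa [e] using e2)).2
    linarith
  have h2 := intervalIntegral.integral_mono_on (μ := volume) zero_le_one
    (intervalIntegrable_const) (Continuous.intervalIntegrable (u := fun z => g z ^ 2) (by fun_prop) _ _) h1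
  simp only [intervalIntegral.integral_const, sub_zero, one_smul] at h2
  have h3 : ∫ s in (0:ℝ)..1, (2 * g s ^ 2 + g' s ^ 2) = (∫ s in (0:ℝ)..1, (g s ^ 2))
      + ∫ s in (0:ℝ)..1, (g s ^ 2 + g' s ^ 2) := by
    rw [← intervalIntegral.integral_add (Continuous.intervalIntegrable (by fun_prop) _ _)
      (Continuous.intervalIntegrable (by fun_prop) _ _)]
    congr 1; funext s; ring
  linarith

lemma aux_sup2 {f : ℝ × ℝ → ℝ} (hf : ContDiff ℝ ∞ f) {x : ℝ × ℝ} (hx : x ∈ Oset) :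
    f x ^ 2 ≤ 4 * Jw 0 f + 2 * Jw 0 (pd2 f) + 2 * Jw 0 (pd1 f) + Jw 0 (pd2 (pd1 f)) := by
  obtain ⟨x1, x2⟩ := x
  obtain ⟨h1, h2⟩ := hx
  have hc := hf.continuous
  have s1 := aux_pd1_smooth hf
  have c1 := s1.continuous
  have c2 := (aux_pd2_smooth hf).continuous
  have c21 := (aux_pd2_smooth s1).continuous
  have A := aux_sup1 (fun s => aux_hasDeriv1 hf s x2) (by fun_prop) (Set.Ioo_subset_Icc_self h1)
  have B : ∀ s ∈ Set.Icc (0:ℝ) 1, 2 * f (s, x2) ^ 2 + pd1 f (s, x2) ^ 2 ≤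
      ∫ r in (0:ℝ)..1, (2 * (2 * f (s, r) ^ 2 + pd2 f (s, r) ^ 2)
        + (2 * pd1 f (s, r) ^ 2 + pd2 (pd1 f) (s, r) ^ 2)) := by
    intro s _
    have b1 := aux_sup1 (fun r => aux_hasDeriv2 hf s r) (by fun_prop) (Set.Ioo_subset_Icc_self h2)
    have b2 := aux_sup1 (fun r => aux_hasDeriv2 s1 s r) (by fun_prop) (Set.Ioo_subset_Icc_self h2)
    rw [intervalIntegral.integral_add (Continuous.intervalIntegrable (by fun_prop) _ _)
      (Continuous.intervalIntegrable (by fun_prop) _ _), intervalIntegral.integral_const_mul]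
    simp only at b1 b2
    linarith
  have C := intervalIntegral.integral_mono_on (μ := volume) zero_le_one
    (Continuous.intervalIntegrable (by fun_prop) _ _)
    (Continuous.intervalIntegrable
      (by apply intervalIntegral.continuous_parametric_intervalIntegral_of_continuous'; fun_prop) _ _) B
  rw [← aux_fubini (f := fun x => 2 * (2 * f x ^ 2 + pd2 f x ^ 2)
        + (2 * pd1 f x ^ 2 + pd2 (pd1 f) x ^ 2)) (by fun_prop)] at C
  refine (A.trans C).trans (le_of_eq ?_)
  have j1 : IntegrableOn (fun x => f x ^ 2) Oset := aux_int (by fun_prop)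
  have j2 : IntegrableOn (fun x => pd2 f x ^ 2) Oset := aux_int (by fun_prop)
  have j3 : IntegrableOn (fun x => pd1 f x ^ 2) Oset := aux_int (by fun_prop)
  have j4 : IntegrableOn (fun x => pd2 (pd1 f) x ^ 2) Oset := aux_int (by fun_prop)
  have j12 : IntegrableOn (fun x => 2 * (2 * f x ^ 2 + pd2 f x ^ 2)) Oset := aux_int (by fun_prop)
  have j34 : IntegrableOn (fun x => 2 * pd1 f x ^ 2 + pd2 (pd1 f) x ^ 2) Oset :=
    aux_int (by fun_prop)
  rw [integral_add j12 j34,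
    integral_const_mul, integral_add (j1.const_mul 2) j2, integral_add (j3.const_mul 2) j4,
    integral_const_mul, integral_const_mul]
  simp only [Jw, pow_zero, one_mul]
  ring

lemma aux_rho_nonneg {C₁ C₂ : ℝ} (hC₁ : 0 < C₁) {ρ₀ : ℝ × ℝ → ℝ} (h : IsDensity C₁ C₂ ρ₀)
    {x : ℝ × ℝ} (hx : x ∈ Oset) : C₁ * (x.2 * (1 - x.2)) ≤ ρ₀ x := by
  refine le_trans ?_ (h.2.2.2 x hx).1
  obtain ⟨-, h0, h1⟩ := hx
  apply mul_le_mul_of_nonneg_left _ hC₁.le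
  unfold distG
  apply le_min <;> nlinarith

lemma aux_rho_nonneg' {C₁ C₂ : ℝ} (hC₁ : 0 < C₁) {ρ₀ : ℝ × ℝ → ℝ} (h : IsDensity C₁ C₂ ρ₀)
    {x : ℝ × ℝ} (hx : x ∈ Oset) : 0 ≤ ρ₀ x := by
  refine le_trans ?_ (aux_rho_nonneg hC₁ h hx)
  obtain ⟨-, h0, h1⟩ := hx
  exact mul_nonneg hC₁.le (mul_nonneg h0.le (by linarith))

lemma aux_J_le {C₁ C₂ : ℝ} (hC₁ : 0 < C₁) {ρ₀ : ℝ × ℝ → ℝ} (h : IsDensity C₁ C₂ ρ₀)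
    {g : ℝ × ℝ → ℝ × ℝ} (hg : ContDiff ℝ ∞ g) (L : ℝ × ℝ →L[ℝ] ℝ) (hL : ∀ w, |L w| ≤ ‖w‖)
    {k : ℕ} (hk : k ≤ 4) {E : ℝ} (hE : ∫ x in Oset, ρ₀ x ^ k * ‖g x‖ ^ 2 ≤ E) :
    Jw k (fun x => L (g x)) ≤ (max 1 (1 / C₁)) ^ 4 * E := by
  have hgc := hg.continuous
  have hρ : Continuous ρ₀ := (h.1 0).continuous
  set M := max 1 (1 / C₁) with hM
  have hM1 : 1 ≤ M := le_max_left _ _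
  have hM2 : 1 / C₁ ≤ M := le_max_right _ _
  have hM3 : 1 ≤ M * C₁ := by
    rw [div_le_iff₀ hC₁] at hM2; exact hM2
  refine le_trans ?_ (mul_le_mul_of_nonneg_left hE (by positivity))
  rw [← integral_const_mul]
  apply setIntegral_mono_on (aux_int (by fun_prop)) (aux_int (by fun_prop)) aux_meas
  intro x hx
  have hr := aux_rho_nonneg hC₁ h hx
  have hr0 := aux_rho_nonneg' hC₁ h hx
  obtain ⟨-, h0, h1⟩ := hx
  have hp : 0 ≤ x.2 * (1 - x.2) := mul_nonneg h0.le (by linarith)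
  have e1 : x.2 * (1 - x.2) ≤ M * ρ₀ x := by
    calc x.2 * (1 - x.2) = 1 * (x.2 * (1 - x.2)) := by ring
      _ ≤ (M * C₁) * (x.2 * (1 - x.2)) := mul_le_mul_of_nonneg_right hM3 hp
      _ = M * (C₁ * (x.2 * (1 - x.2))) := by ring
      _ ≤ _ := mul_le_mul_of_nonneg_left hr (by positivity)
  have e2 : (x.2 * (1 - x.2)) ^ k ≤ M ^ 4 * ρ₀ x ^ k := by
    calc (x.2 * (1 - x.2)) ^ k ≤ (M * ρ₀ x) ^ k := pow_le_pow_left₀ hp e1 k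
      _ = M ^ k * ρ₀ x ^ k := by rw [mul_pow]
      _ ≤ _ := mul_le_mul_of_nonneg_right (pow_le_pow_right₀ hM1 hk) (by positivity)
  have e3 : L (g x) ^ 2 ≤ ‖g x‖ ^ 2 := by
    rw [← sq_abs]
    exact pow_le_pow_left₀ (abs_nonneg _) (hL _) 2
  calc (x.2 * (1 - x.2)) ^ k * L (g x) ^ 2 ≤ (M ^ 4 * ρ₀ x ^ k) * ‖g x‖ ^ 2 := by gcongr
    _ = _ := by ring

lemma aux_gradSq_nonneg (f : ℝ × ℝ → F) (x : ℝ × ℝ) : 0 ≤ gradSq f x := by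
  unfold gradSq; positivity

lemma aux_E2 {C₁ C₂ : ℝ} (hC₁ : 0 < C₁) {ρ₀ : ℝ × ℝ → ℝ} (h : IsDensity C₁ C₂ ρ₀)
    (v : ℝ → ℝ × ℝ → ℝ × ℝ) (t : ℝ) {l : ℕ} (hl : l < 7) :
    ∫ x in Oset, ρ₀ x * (gradSq (pd1^[l] (v t)) x + gradSq (pd1^[l + 1] (v t)) x)
      ≤ energy ρ₀ v t := by
  have n1 : 0 ≤ ∑ l₀ ∈ Finset.range 5, ∫ x in Oset, ρ₀ x * ‖(pdt^[l₀] v) t x‖ ^ 2 := by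
    refine Finset.sum_nonneg fun i _ => setIntegral_nonneg aux_meas fun x hx => ?_
    have := aux_rho_nonneg' hC₁ h hx
    positivity
  have n2 : ∀ l₀ l₁ : ℕ, 0 ≤ ∫ x in Oset, ρ₀ x *
          (gradSq (pd1^[l₁] ((pdt^[l₀] v) t)) x + gradSq (pd1^[l₁ + 1] ((pdt^[l₀] v) t)) x) := by
    intro l₀ l₁
    refine setIntegral_nonneg aux_meas fun x hx => ?_
    exact mul_nonneg (aux_rho_nonneg' hC₁ h hx)
      (add_nonneg (aux_gradSq_nonneg _ _) (aux_gradSq_nonneg _ _))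
  have n3 : 0 ≤ ∑ l₀ ∈ Finset.range 4, ∑ l₁ ∈ Finset.range (7 - 2 * l₀),
        ∑ l₂ ∈ Finset.Icc 2 (8 - 2 * l₀ - l₁),
          ∫ x in Oset, ρ₀ x ^ l₂ * ‖(pd1^[l₁] (pd2^[l₂] ((pdt^[l₀] v) t))) x‖ ^ 2 := by
    refine Finset.sum_nonneg fun i _ => Finset.sum_nonneg fun j _ => Finset.sum_nonneg fun m _ =>
      setIntegral_nonneg aux_meas fun x hx => ?_
    have := aux_rho_nonneg' hC₁ h hx
    positivity
  have s1 := Finset.single_le_sum (f := fun l₁ => ∫ x in Oset, ρ₀ x *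
          (gradSq (pd1^[l₁] ((pdt^[0] v) t)) x + gradSq (pd1^[l₁ + 1] ((pdt^[0] v) t)) x))
    (s := Finset.range (7 - 2 * 0)) (fun i _ => n2 0 i) (Finset.mem_range.2 hl)
  have s2 := Finset.single_le_sum (f := fun l₀ => ∑ l₁ ∈ Finset.range (7 - 2 * l₀),
        ∫ x in Oset, ρ₀ x *
          (gradSq (pd1^[l₁] ((pdt^[l₀] v) t)) x + gradSq (pd1^[l₁ + 1] ((pdt^[l₀] v) t)) x))
    (s := Finset.range 4) (fun i _ => Finset.sum_nonneg fun j _ => n2 i j)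
    (Finset.mem_range.2 (show 0 < 4 by norm_num))
  have s3 := s1.trans s2
  unfold energy
  simp only [Function.iterate_zero, id] at s3
  linarith

lemma aux_E3 {C₁ C₂ : ℝ} (hC₁ : 0 < C₁) {ρ₀ : ℝ × ℝ → ℝ} (h : IsDensity C₁ C₂ ρ₀)
    (v : ℝ → ℝ × ℝ → ℝ × ℝ) (t : ℝ) {a b : ℕ} (ha : a < 7) (hb : 2 ≤ b) (hab : a + b ≤ 8) :
    ∫ x in Oset, ρ₀ x ^ b * ‖(pd1^[a] (pd2^[b] (v t))) x‖ ^ 2 ≤ energy ρ₀ v t := by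
  have n1 : 0 ≤ ∑ l₀ ∈ Finset.range 5, ∫ x in Oset, ρ₀ x * ‖(pdt^[l₀] v) t x‖ ^ 2 := by
    refine Finset.sum_nonneg fun i _ => setIntegral_nonneg aux_meas fun x hx => ?_
    have := aux_rho_nonneg' hC₁ h hx
    positivity
  have n2 : 0 ≤ ∑ l₀ ∈ Finset.range 4, ∑ l₁ ∈ Finset.range (7 - 2 * l₀),
        ∫ x in Oset, ρ₀ x *
          (gradSq (pd1^[l₁] ((pdt^[l₀] v) t)) x + gradSq (pd1^[l₁ + 1] ((pdt^[l₀] v) t)) x) := by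
    refine Finset.sum_nonneg fun i _ => Finset.sum_nonneg fun j _ =>
      setIntegral_nonneg aux_meas fun x hx => ?_
    exact mul_nonneg (aux_rho_nonneg' hC₁ h hx)
      (add_nonneg (aux_gradSq_nonneg _ _) (aux_gradSq_nonneg _ _))
  have n3 : ∀ l₀ l₁ l₂ : ℕ, 0 ≤
          ∫ x in Oset, ρ₀ x ^ l₂ * ‖(pd1^[l₁] (pd2^[l₂] ((pdt^[l₀] v) t))) x‖ ^ 2 := by
    intro i j m
    refine setIntegral_nonneg aux_meas fun x hx => ?_
    have := aux_rho_nonneg' hC₁ h hx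
    positivity
  have s0 := Finset.single_le_sum (f := fun l₂ => ∫ x in Oset,
      ρ₀ x ^ l₂ * ‖(pd1^[a] (pd2^[l₂] ((pdt^[0] v) t))) x‖ ^ 2)
    (s := Finset.Icc 2 (8 - 2 * 0 - a)) (fun i _ => n3 0 a i)
    (Finset.mem_Icc.2 (show 2 ≤ b ∧ b ≤ 8 - 2 * 0 - a by omega))
  have s1 := Finset.single_le_sum (f := fun l₁ => ∑ l₂ ∈ Finset.Icc 2 (8 - 2 * 0 - l₁),
      ∫ x in Oset, ρ₀ x ^ l₂ * ‖(pd1^[l₁] (pd2^[l₂] ((pdt^[0] v) t))) x‖ ^ 2)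
    (s := Finset.range (7 - 2 * 0)) (fun i _ => Finset.sum_nonneg fun j _ => n3 0 i j)
    (Finset.mem_range.2 ha)
  have s2 := Finset.single_le_sum (f := fun l₀ => ∑ l₁ ∈ Finset.range (7 - 2 * l₀),
        ∑ l₂ ∈ Finset.Icc 2 (8 - 2 * l₀ - l₁),
          ∫ x in Oset, ρ₀ x ^ l₂ * ‖(pd1^[l₁] (pd2^[l₂] ((pdt^[l₀] v) t))) x‖ ^ 2)
    (s := Finset.range 4) (fun i _ => Finset.sum_nonneg fun j _ =>
      Finset.sum_nonneg fun m _ => n3 i j m)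
    (Finset.mem_range.2 (show 0 < 4 by norm_num))
  have s3 := (s0.trans s1).trans s2
  unfold energy
  simp only [Function.iterate_zero, id] at s3
  linarith

lemma aux_pointwise {C₁ C₂ : ℝ} (hC₁ : 0 < C₁) {ρ₀ : ℝ × ℝ → ℝ} (h : IsDensity C₁ C₂ ρ₀)
    {v : ℝ → ℝ × ℝ → ℝ × ℝ} {t : ℝ} (hv : ContDiff ℝ ∞ (v t))
    (L : ℝ × ℝ →L[ℝ] ℝ) (hL : ∀ w, |L w| ≤ ‖w‖) {x : ℝ × ℝ} (hx : x ∈ Oset) :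
    |L (pd1 (pd1^[3] (v t)) x)| ≤ 40 * (max 1 (1 / C₁)) ^ 2 * √(energy ρ₀ v t) ∧
    |L (pd2 (pd1^[3] (v t)) x)| ≤ 40 * (max 1 (1 / C₁)) ^ 2 * √(energy ρ₀ v t) := by
  set E := energy ρ₀ v t with hE
  set M := max 1 (1 / C₁) with hM
  have hM1 : 1 ≤ M := le_max_left _ _
  have hρ : Continuous ρ₀ := (h.1 0).continuous
  have hs : ∀ a b : ℕ, ContDiff ℝ ∞ (pd1^[a] (pd2^[b] (v t))) := fun a b =>
    aux_pd1_iter (aux_pd2_iter hv b) a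
  let G : ℕ → ℕ → ℝ × ℝ → ℝ := fun a b x => L (pd1^[a] (pd2^[b] (v t)) x)
  have hG : ∀ a b, ContDiff ℝ ∞ (G a b) := fun a b => L.contDiff.comp (hs a b)
  have hG1 : ∀ a b, pd1 (G a b) = G (a+1) b := by
    intro a b
    simp only [G]
    rw [aux_clm_pd1 (hs a b) L, Function.iterate_succ_apply']
  have hG2 : ∀ a b, pd2 (G a b) = G a (b+1) := by
    intro a b
    simp only [G]
    rw [aux_clm_pd2 (hs a b) L, Function.iterate_succ_apply',
      aux_comm_iter (aux_pd2_iter hv b)]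
  have T : ∀ l < 7, (∫ x in Oset, ρ₀ x ^ 1 * ‖pd1^[l+1] (pd2^[0] (v t)) x‖ ^ 2 ≤ E) ∧
      ∫ x in Oset, ρ₀ x ^ 1 * ‖pd1^[l] (pd2^[1] (v t)) x‖ ^ 2 ≤ E := by
    intro l hl
    have c0 := (hs (l+1) 0).continuous
    have c1 := (hs l 1).continuous
    have q1 := (aux_pd1_smooth (hs l 0)).continuous
    have q2 := (aux_pd2_smooth (hs l 0)).continuous
    have q3 := (aux_pd1_smooth (hs (l+1) 0)).continuous
    have q4 := (aux_pd2_smooth (hs (l+1) 0)).continuous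
    simp only [Function.iterate_zero, id] at c0 c1 q1 q2 q3 q4
    have key := aux_E2 hC₁ h v t hl
    have e : pd1^[l] (pd2^[1] (v t)) = pd2 (pd1^[l] (v t)) := (aux_comm_iter hv l).symm
    have hi : IntegrableOn (fun x => ρ₀ x * (gradSq (pd1^[l] (v t)) x
        + gradSq (pd1^[l + 1] (v t)) x)) Oset := by
      apply aux_int
      unfold gradSq
      fun_prop
    constructor
    · refine le_trans (setIntegral_mono_on (aux_int (by fun_prop)) hi aux_meas ?_) key
      intro x hx
      have := aux_rho_nonneg' hC₁ h hx
      rw [pow_one, Function.iterate_succ_apply']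
      apply mul_le_mul_of_nonneg_left _ this
      have := aux_gradSq_nonneg (pd1^[l + 1] (v t)) x
      rw [Function.iterate_succ_apply'] at this
      simp only [gradSq, Function.iterate_zero, id] at this ⊢
      nlinarith [sq_nonneg ‖pd2 (pd1^[l] (v t)) x‖]
    · refine le_trans (setIntegral_mono_on (aux_int (by fun_prop)) hi aux_meas ?_) key
      intro x hx
      have := aux_rho_nonneg' hC₁ h hx
      rw [pow_one, e]
      apply mul_le_mul_of_nonneg_left _ this
      have := aux_gradSq_nonneg (pd1^[l + 1] (v t)) x
      simp only [gradSq] at this ⊢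
      nlinarith [sq_nonneg ‖pd1 (pd1^[l] (v t)) x‖]
  have W0 : ∀ l < 7, Jw 1 (G (l+1) 0) ≤ M ^ 4 * E := fun l hl =>
    aux_J_le hC₁ h (hs (l+1) 0) L hL (by norm_num) (T l hl).1
  have W1 : ∀ l < 7, Jw 1 (G l 1) ≤ M ^ 4 * E := fun l hl =>
    aux_J_le hC₁ h (hs l 1) L hL (by norm_num) (T l hl).2
  have W2 : ∀ a b : ℕ, a < 7 → 2 ≤ b → b ≤ 4 → a + b ≤ 8 → Jw b (G a b) ≤ M ^ 4 * E :=
    fun a b ha hb hb4 hab => aux_J_le hC₁ h (hs a b) L hL hb4 (aux_E3 hC₁ h v t ha hb hab)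
  have A0 : ∀ l < 6, Jw 0 (G (l+1) 0) ≤ 16 * (M ^ 4 * E) := by
    intro l hl
    have := aux_hardy 0 (hG (l+1) 0)
    rw [hG2] at this
    have b1 := W0 l (by omega)
    have b2 := (aux_Jw_succ 1 (hG (l+1) 1)).trans (W1 (l+1) (by omega))
    norm_num at this b1 b2
    linarith
  have A1 : ∀ l < 7, Jw 0 (G l 1) ≤ 16 * (M ^ 4 * E) := by
    intro l hl
    have := aux_hardy 0 (hG l 1)
    rw [hG2] at this
    have b1 := W1 l (by omega)
    have b2 := W2 l 2 (by omega) (by omega) (by omega) (by omega)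
    norm_num at this b1 b2
    linarith
  have A2 : ∀ l ≤ 4, Jw 0 (G l 2) ≤ 416 * (M ^ 4 * E) := by
    intro l hl
    have h0 := aux_hardy 0 (hG l 2)
    have h1 := aux_hardy 1 (hG l 2)
    have h2 := aux_hardy 2 (hG l 3)
    rw [hG2] at h0 h1 h2
    have b2 := W2 l 2 (by omega) (by omega) (by omega) (by omega)
    have b3 := W2 l 3 (by omega) (by omega) (by omega) (by omega)
    have b4 := W2 l 4 (by omega) (by omega) (by omega) (by omega)
    norm_num at h0 h1 h2 b2 b3 b4
    linarith
  have hE0 : 0 ≤ M ^ 4 * E := (aux_Jw_nonneg _ _).trans (W1 0 (by norm_num))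
  have hEn : 0 ≤ E := by
    by_contra hcon
    have : 0 < M ^ 4 := by positivity
    nlinarith
  have fin : ∀ y : ℝ, y ^ 2 ≤ 1600 * (M ^ 4 * E) → |y| ≤ 40 * M ^ 2 * √E := by
    intro y hy
    apply abs_le_of_sq_le_sq _ (by positivity)
    have : (40 * M ^ 2 * √E) ^ 2 = 1600 * (M ^ 4 * E) := by
      rw [mul_pow, Real.sq_sqrt hEn]; ring
    rw [this]; exact hy
  have r1 : L (pd1 (pd1^[3] (v t)) x) = G 4 0 x := by
    simp only [G]; rw [Function.iterate_succ_apply' (n := 3)]; rfl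
  have r2 : L (pd2 (pd1^[3] (v t)) x) = G 3 1 x := by
    simp only [G]; rw [aux_comm_iter hv]; rfl
  rw [r1, r2]
  constructor
  · apply fin
    have := aux_sup2 (hG 4 0) hx
    rw [hG1, hG2, hG2] at this
    have a1 := A0 3 (by norm_num)
    have a2 := A0 4 (by norm_num)
    have a3 := A1 4 (by norm_num)
    have a4 := A1 5 (by norm_num)
    norm_num at this a1 a2 a3 a4
    linarith
  · apply fin
    have := aux_sup2 (hG 3 1) hx
    rw [hG1, hG2, hG2] at this
    have a1 := A1 3 (by norm_num)
    have a2 := A1 4 (by norm_num)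
    have a3 := A2 3 (by norm_num)
    have a4 := A2 4 (by norm_num)
    norm_num at this a1 a2 a3 a4
    linarith

lemma aux_first {C₁ C₂ : ℝ} (hC₁ : 0 < C₁) {ρ₀ : ℝ × ℝ → ℝ} (h : IsDensity C₁ C₂ ρ₀)
    {v : ℝ → ℝ × ℝ → ℝ × ℝ} {t : ℝ} (hv : ContDiff ℝ ∞ (v t)) {x : ℝ × ℝ} (hx : x ∈ Oset) :
    ‖fderiv ℝ (pd1^[3] (v t)) x‖ ≤ 80 * (max 1 (1 / C₁)) ^ 2 * √(energy ρ₀ v t) := by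
  set B := 40 * (max 1 (1 / C₁)) ^ 2 * √(energy ρ₀ v t) with hB
  have p1 := aux_pointwise hC₁ h hv (ContinuousLinearMap.fst ℝ ℝ ℝ)
    (fun w => by simpa using norm_fst_le w) hx
  have p2 := aux_pointwise hC₁ h hv (ContinuousLinearMap.snd ℝ ℝ ℝ)
    (fun w => by simpa using norm_snd_le w) hx
  have q1 : ‖pd1 (pd1^[3] (v t)) x‖ ≤ B := by
    rw [Prod.norm_def]; exact max_le p1.1 p2.1
  have q2 : ‖pd2 (pd1^[3] (v t)) x‖ ≤ B := by
    rw [Prod.norm_def]; exact max_le p1.2 p2.2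
  have hB0 : 0 ≤ B := (norm_nonneg _).trans q1
  have : 80 * (max 1 (1 / C₁)) ^ 2 * √(energy ρ₀ v t) = 2 * B := by rw [hB]; ring
  rw [this]
  apply ContinuousLinearMap.opNorm_le_bound _ (by positivity)
  intro w
  have hw : w = w.1 • ((1:ℝ), (0:ℝ)) + w.2 • ((0:ℝ), (1:ℝ)) := by ext <;> simp
  have e : fderiv ℝ (pd1^[3] (v t)) x w = w.1 • pd1 (pd1^[3] (v t)) x
      + w.2 • pd2 (pd1^[3] (v t)) x := by
    conv_lhs => rw [hw]
    rw [map_add, map_smul, map_smul]; rfl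
  rw [e]
  refine (norm_add_le _ _).trans ?_
  rw [norm_smul, norm_smul]
  have w1 := norm_fst_le w
  have w2 := norm_snd_le w
  calc ‖w.1‖ * _ + ‖w.2‖ * _ ≤ ‖w‖ * B + ‖w‖ * B := by gcongr
    _ = _ := by ring

lemma aux_slice {w : ℝ → ℝ × ℝ → F} (hw : ContDiff ℝ ∞ (Function.uncurry w)) (t : ℝ) :
    ContDiff ℝ ∞ (w t) :=
  hw.comp (contDiff_const.prodMk contDiff_id)

lemma aux_T_pd1 {w : ℝ → ℝ × ℝ → F} (hw : ContDiff ℝ ∞ (Function.uncurry w)) :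
    ContDiff ℝ ∞ (Function.uncurry (fun t => pd1 (w t))) := by
  have : ContDiff ℝ ∞ (fun p : ℝ × (ℝ × ℝ) => fderiv ℝ (w p.1) p.2) := by
    apply ContDiff.fderiv (m := ∞) (n := ∞) (f := fun p : ℝ × (ℝ × ℝ) => w p.1)
    · exact hw.comp (contDiff_fst.fst.prodMk contDiff_snd)
    · exact contDiff_snd
    · simp
  exact this.clm_apply contDiff_const

lemma aux_T_pd2 {w : ℝ → ℝ × ℝ → F} (hw : ContDiff ℝ ∞ (Function.uncurry w)) :
    ContDiff ℝ ∞ (Function.uncurry (fun t => pd2 (w t))) := by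
  have : ContDiff ℝ ∞ (fun p : ℝ × (ℝ × ℝ) => fderiv ℝ (w p.1) p.2) := by
    apply ContDiff.fderiv (m := ∞) (n := ∞) (f := fun p : ℝ × (ℝ × ℝ) => w p.1)
    · exact hw.comp (contDiff_fst.fst.prodMk contDiff_snd)
    · exact contDiff_snd
    · simp
  exact this.clm_apply contDiff_const

lemma aux_T_pdt {w : ℝ → ℝ × ℝ → F} (hw : ContDiff ℝ ∞ (Function.uncurry w)) :
    ContDiff ℝ ∞ (Function.uncurry (pdt w)) := by
  have : ContDiff ℝ ∞ (fun p : ℝ × (ℝ × ℝ) => fderiv ℝ (fun s => w s p.2) p.1) := by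
    apply ContDiff.fderiv (m := ∞) (n := ∞) (f := fun (p : ℝ × (ℝ × ℝ)) s => w s p.2)
    · exact hw.comp (contDiff_snd.prodMk contDiff_fst.snd)
    · exact contDiff_fst
    · simp
  exact this.clm_apply contDiff_const

lemma aux_T_pd1_iter {w : ℝ → ℝ × ℝ → F} (hw : ContDiff ℝ ∞ (Function.uncurry w)) (n : ℕ) :
    ContDiff ℝ ∞ (Function.uncurry (fun t => pd1^[n] (w t))) := by
  induction n with
  | zero => exact hw
  | succ k ih =>
    simp only [Function.iterate_succ_apply']
    exact aux_T_pd1 ih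

lemma aux_T_pd2_iter {w : ℝ → ℝ × ℝ → F} (hw : ContDiff ℝ ∞ (Function.uncurry w)) (n : ℕ) :
    ContDiff ℝ ∞ (Function.uncurry (fun t => pd2^[n] (w t))) := by
  induction n with
  | zero => exact hw
  | succ k ih =>
    simp only [Function.iterate_succ_apply']
    exact aux_T_pd2 ih

lemma aux_T_pdt_iter {w : ℝ → ℝ × ℝ → F} (hw : ContDiff ℝ ∞ (Function.uncurry w)) (n : ℕ) :
    ContDiff ℝ ∞ (Function.uncurry (pdt^[n] w)) := by
  induction n with
  | zero => exact hw
  | succ k ih =>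
    simp only [Function.iterate_succ_apply']
    exact aux_T_pdt ih

/-- Boundedness above on `[0,t]`. -/
def BdT (t : ℝ) (g : ℝ → ℝ) : Prop := ∃ M, ∀ s ∈ Set.Icc (0:ℝ) t, g s ≤ M

lemma BdT.add {t : ℝ} {g h : ℝ → ℝ} (hg : BdT t g) (hh : BdT t h) : BdT t (fun s => g s + h s) := by
  obtain ⟨M, hM⟩ := hg
  obtain ⟨N, hN⟩ := hh
  exact ⟨M + N, fun s hs => add_le_add (hM s hs) (hN s hs)⟩

lemma BdT.sum {t : ℝ} {S : Finset ℕ} {g : ℕ → ℝ → ℝ} (hg : ∀ i, BdT t (g i)) :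
    BdT t (fun s => ∑ i ∈ S, g i s) := by
  choose M hM using hg
  exact ⟨∑ i ∈ S, M i, fun s hs => Finset.sum_le_sum fun i _ => hM i s hs⟩

lemma aux_BdT {t : ℝ} {h : ℝ → ℝ × ℝ → ℝ} (hh : Continuous (Function.uncurry h)) :
    BdT t (fun s => ∫ x in Oset, h s x) := by
  obtain ⟨M, hM⟩ := (isCompact_Icc.prod ((isCompact_Icc (a := (0:ℝ)) (b := 1)).prod
    (isCompact_Icc (a := (0:ℝ)) (b := 1)))).exists_bound_of_continuousOn
    (s := Set.Icc 0 t ×ˢ (Set.Icc (0:ℝ) 1 ×ˢ Set.Icc (0:ℝ) 1)) hh.continuousOn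
  have hfin : volume Oset < ⊤ := by
    have := (aux_int (f := fun _ => (1:ℝ)) continuous_const)
    rw [integrableOn_const_iff] at this
    simpa using this
  refine ⟨M * volume.real Oset, fun s hs => ?_⟩
  refine (Real.le_norm_self _).trans
    (norm_setIntegral_le_of_norm_le_const (f := h s) hfin ?_)
  intro x hx
  exact hM (s, x) ⟨hs, Set.Ioo_subset_Icc_self hx.1, Set.Ioo_subset_Icc_self hx.2⟩

lemma aux_energy_bdd {ρ₀ : ℝ × ℝ → ℝ} (hρ : Continuous ρ₀) {v : ℝ → ℝ × ℝ → ℝ × ℝ}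
    (hv : ContDiff ℝ ∞ (Function.uncurry v)) (t : ℝ) : BdT t (energy ρ₀ v) := by
  unfold energy
  have g : ∀ l₀ l₁ : ℕ, Continuous (fun p : ℝ × (ℝ × ℝ) =>
      gradSq (pd1^[l₁] ((pdt^[l₀] v) p.1)) p.2) := by
    intro l₀ l₁
    have h1 := (aux_T_pd1 (aux_T_pd1_iter (aux_T_pdt_iter hv l₀) l₁)).continuous
    have h2 := (aux_T_pd2 (aux_T_pd1_iter (aux_T_pdt_iter hv l₀) l₁)).continuous
    exact (h1.norm.pow 2).add (h2.norm.pow 2)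
  refine BdT.add (BdT.add (BdT.sum fun l₀ => ?_) (BdT.sum fun l₀ => BdT.sum fun l₁ => ?_))
    (BdT.sum fun l₀ => BdT.sum fun l₁ => BdT.sum fun l₂ => ?_)
  · apply aux_BdT (h := fun s x => ρ₀ x * ‖(pdt^[l₀] v) s x‖ ^ 2)
    exact (hρ.comp continuous_snd).mul ((aux_T_pdt_iter hv l₀).continuous.norm.pow 2)
  · apply aux_BdT (h := fun s x => ρ₀ x * (gradSq (pd1^[l₁] ((pdt^[l₀] v) s)) x
      + gradSq (pd1^[l₁ + 1] ((pdt^[l₀] v) s)) x))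
    exact (hρ.comp continuous_snd).mul ((g l₀ l₁).add (g l₀ (l₁ + 1)))
  · apply aux_BdT (h := fun s x => ρ₀ x ^ l₂ * ‖(pd1^[l₁] (pd2^[l₂] ((pdt^[l₀] v) s))) x‖ ^ 2)
    exact ((hρ.comp continuous_snd).pow l₂).mul
      ((aux_T_pd1_iter (aux_T_pd2_iter (aux_T_pdt_iter hv l₀) l₂) l₁).continuous.norm.pow 2)

lemma aux_le_supEn {ρ₀ : ℝ × ℝ → ℝ} (hρ : Continuous ρ₀) {v : ℝ → ℝ × ℝ → ℝ × ℝ}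
    (hv : ContDiff ℝ ∞ (Function.uncurry v)) {t s : ℝ} (hs : s ∈ Set.Icc (0:ℝ) t) :
    √(energy ρ₀ v s) ≤ supEn ρ₀ v t := by
  obtain ⟨M, hM⟩ := aux_energy_bdd hρ hv t
  refine le_ciSup (f := fun s : Set.Icc (0:ℝ) t => √(energy ρ₀ v ↑s)) ⟨√M, ?_⟩ ⟨s, hs⟩
  rintro _ ⟨r, rfl⟩
  exact Real.sqrt_le_sqrt (hM r r.2)

lemma aux_pint {w : ℝ → ℝ × ℝ → ℝ × ℝ} (hw : ContDiff ℝ ∞ (Function.uncurry w)) (t : ℝ)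
    (x : ℝ × ℝ) :
    HasFDerivAt (fun y => ∫ s in (0:ℝ)..t, w s y) (∫ s in (0:ℝ)..t, fderiv ℝ (w s) x) x := by
  have hD : ContDiff ℝ ∞ (fun p : ℝ × (ℝ × ℝ) => fderiv ℝ (w p.1) p.2) := by
    apply ContDiff.fderiv (m := ∞) (n := ∞) (f := fun p : ℝ × (ℝ × ℝ) => w p.1)
    · exact hw.comp (contDiff_fst.fst.prodMk contDiff_snd)
    · exact contDiff_snd
    · simp
  have hDc := hD.continuous
  obtain ⟨M, hM⟩ := ((isCompact_uIcc (a := (0:ℝ)) (b := t)).prod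
    (isCompact_closedBall x 1)).exists_bound_of_continuousOn hDc.continuousOn
  have hwc := hw.continuous
  have hslice : ∀ y : ℝ × ℝ, Continuous (fun s => w s y) := fun y =>
    hwc.comp (continuous_id.prodMk continuous_const)
  have hslice' : Continuous (fun s => fderiv ℝ (w s) x) :=
    hDc.comp (continuous_id.prodMk continuous_const)
  apply intervalIntegral.hasFDerivAt_integral_of_dominated_of_fderiv_le
    (F := fun y s => w s y) (F' := fun y s => fderiv ℝ (w s) y) (bound := fun _ => M)
    (Metric.closedBall_mem_nhds x one_pos)
  · exact Eventually.of_forall fun y => (hslice y).aestronglyMeasurable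
  · exact (hslice x).intervalIntegrable _ _
  · exact hslice'.aestronglyMeasurable
  · exact Eventually.of_forall fun s hs y hy => hM (s, y) ⟨Set.uIoc_subset_uIcc hs, hy⟩
  · exact intervalIntegrable_const
  · exact Eventually.of_forall fun s _ y _ =>
      ((aux_slice hw s).differentiable (by simp) y).hasFDerivAt

lemma aux_pint_apply {w : ℝ → ℝ × ℝ → ℝ × ℝ} (hw : ContDiff ℝ ∞ (Function.uncurry w)) (t : ℝ)
    (x e : ℝ × ℝ) :
    (∫ s in (0:ℝ)..t, fderiv ℝ (w s) x) e = ∫ s in (0:ℝ)..t, fderiv ℝ (w s) x e := by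
  have hD : ContDiff ℝ ∞ (fun p : ℝ × (ℝ × ℝ) => fderiv ℝ (w p.1) p.2) := by
    apply ContDiff.fderiv (m := ∞) (n := ∞) (f := fun p : ℝ × (ℝ × ℝ) => w p.1)
    · exact hw.comp (contDiff_fst.fst.prodMk contDiff_snd)
    · exact contDiff_snd
    · simp
  have hslice' : Continuous (fun s => fderiv ℝ (w s) x) :=
    hD.continuous.comp (continuous_id.prodMk continuous_const)
  exact ContinuousLinearMap.intervalIntegral_apply (hslice'.intervalIntegrable _ _) e

lemma aux_pint_pd1 {w : ℝ → ℝ × ℝ → ℝ × ℝ} (hw : ContDiff ℝ ∞ (Function.uncurry w)) (t : ℝ) :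
    pd1 (fun y => ∫ s in (0:ℝ)..t, w s y) = fun y => ∫ s in (0:ℝ)..t, pd1 (w s) y := by
  funext x
  unfold pd1
  rw [(aux_pint hw t x).fderiv, aux_pint_apply hw]

lemma aux_flow {v : ℝ → ℝ × ℝ → ℝ × ℝ} (hv : ContDiff ℝ ∞ (Function.uncurry v)) (t : ℝ) :
    pd1^[3] (flowMap v t) = fun y => ∫ s in (0:ℝ)..t, pd1^[3] (v s) y := by
  have h1 : pd1 (flowMap v t) = fun y => (1, 0) + ∫ s in (0:ℝ)..t, pd1 (v s) y := by
    funext x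
    have e : HasFDerivAt (flowMap v t) (ContinuousLinearMap.id ℝ (ℝ × ℝ)
        + ∫ s in (0:ℝ)..t, fderiv ℝ (v s) x) x := (hasFDerivAt_id x).add (aux_pint hv t x)
    unfold pd1
    rw [e.fderiv, add_apply, aux_pint_apply hv]
    rfl
  have h2 : pd1 (pd1 (flowMap v t)) = fun y => ∫ s in (0:ℝ)..t, pd1 (pd1 (v s)) y := by
    rw [h1, ← aux_pint_pd1 (aux_T_pd1 hv)]
    funext x
    unfold pd1
    rw [fderiv_const_add]
  change pd1 (pd1 (pd1 (flowMap v t))) = _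
  rw [h2, aux_pint_pd1 (aux_T_pd1 (aux_T_pd1 hv))]
  rfl

/-- (Lemma 3.8.) `‖∂₁³Dv(t)‖_{L^∞(Ω)} ≤ C E(t,v)^{1/2}`, and consequently
`‖∂₁³Dη(t)‖_{L^∞(Ω)} ≤ C t sup_{0≤s≤t} E(s,v)^{1/2}` for the flow map `η`. -/
theorem stmt5 (C₁ C₂ : ℝ) (hC₁ : 0 < C₁) (hC₁₂ : C₁ ≤ C₂) :
    ∃ C > (0:ℝ),
      ∀ ρ₀ : ℝ × ℝ → ℝ, IsDensity C₁ C₂ ρ₀ →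
        ∀ T : ℝ, 0 ≤ T →
          ∀ v : ℝ → ℝ × ℝ → ℝ × ℝ, SmoothT v → PerT v →
            ∀ t ∈ Set.Icc (0:ℝ) T,
              (∀ x ∈ Oset, ‖iteratedFDeriv ℝ 1 (pd1^[3] (v t)) x‖
                  ≤ C * Real.sqrt (energy ρ₀ v t)) ∧
              (∀ x ∈ Oset, ‖iteratedFDeriv ℝ 1 (pd1^[3] (flowMap v t)) x‖
                  ≤ C * t * supEn ρ₀ v t) := by
  set M := max 1 (1 / C₁) with hM
  have hM1 : 1 ≤ M := le_max_left _ _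
  refine ⟨80 * M ^ 2, by positivity, ?_⟩
  intro ρ₀ hρ T _ v hv _ t ht
  have hV : ContDiff ℝ ∞ (Function.uncurry v) := contDiff_infty.2 hv
  have hρc : Continuous ρ₀ := (hρ.1 0).continuous
  have first : ∀ s : ℝ, ∀ x ∈ Oset, ‖fderiv ℝ (pd1^[3] (v s)) x‖
      ≤ 80 * M ^ 2 * √(energy ρ₀ v s) := fun s x hx => aux_first hC₁ hρ (aux_slice hV s) hx
  constructor
  · intro x hx
    rw [norm_iteratedFDeriv_one]
    exact first t x hx
  · intro x hx
    rw [norm_iteratedFDeriv_one, aux_flow hV t,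
      (aux_pint (aux_T_pd1_iter hV 3) t x).fderiv]
    have := intervalIntegral.norm_integral_le_of_norm_le_const (a := 0) (b := t)
      (C := 80 * M ^ 2 * supEn ρ₀ v t) (f := fun s => fderiv ℝ (pd1^[3] (v s)) x) (by
        intro s hs
        rw [Set.uIoc_of_le ht.1] at hs
        refine (first s x hx).trans ?_
        exact mul_le_mul_of_nonneg_left (aux_le_supEn hρc hV ⟨hs.1.le, hs.2⟩) (by positivity))
    rw [sub_zero, abs_of_nonneg ht.1] at this
    refine this.trans (le_of_eq (by ring))
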